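/- arXiv:2605.31496 — 2 statements merged into one kernel-verified Lean document; each statement's English description precedes it below -/
import Mathlib

section
/- Let φ : ℝ → ℝ be continuous with φ(x) = 0 for x ≤ 0, φ(x) = 1 for x ≥ 1, and φ continuously differentiable on [0,1], with ‖φ'‖_∞ := sup_{t∈[0,1]} |φ'(t)|. Let r ≥ 1 be an integer, set a_j := φ(j/r) for all j ∈ ℕ, and let 0 ≤ k ≤ r. Then for any univariate real polynomial Q such that Q(x) = ∫_{−1}^{1} T_k(y)·S_r^{(a)}(x,y)² dμ(y) for all x ∈ ℝ, one has ‖Q − M_r^{(a)}·T_k‖_{1,cheb} ≤ φ(k/r)² + (3k²/(2r))·‖φ'‖_∞². -/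
open Polynomial MeasureTheory

/-- The k-th Chebyshev polynomial of the first kind over ℝ. -/
noncomputable def chebT (k : ℕ) : Polynomial ℝ := Polynomial.Chebyshev.T ℝ (k : ℤ)

/-- The Chebyshev 1-norm of a univariate real polynomial: the sum of the absolute
values of the coefficients in the (unique) expansion in the Chebyshev basis. -/
noncomputable def cheb1Norm (p : Polynomial ℝ) : ℝ :=
  sInf {s : ℝ | ∃ c : ℕ →₀ ℝ,
    p = c.sum (fun j coef => Polynomial.C coef * chebT j) ∧ s = c.sum (fun _ coef => |coef|)}

/-- The Chebyshev probability measure on `[-1,1]`, `dμ(y) = dy/(π √(1-y²))`. -/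
noncomputable def chebMeasure : Measure ℝ :=
  (volume.restrict (Set.Icc (-1 : ℝ) 1)).withDensity
    (fun y => ENNReal.ofReal (1 / (Real.pi * Real.sqrt (1 - y ^ 2))))

/-- The kernel `S_r^{(a)}(x,y) = 1 + 2∑_{j=1}^r (1-a_j) T_j(x) T_j(y)`. -/
noncomputable def Sker (r : ℕ) (a : ℕ → ℝ) (x y : ℝ) : ℝ :=
  1 + 2 * ∑ j ∈ Finset.Icc 1 r, (1 - a j) * (chebT j).eval x * (chebT j).eval y

/-- `M_r^{(a)}` as a polynomial, `M_r^{(a)} = 1 + 2∑_{j=1}^r (1-a_j)² T_j²`. -/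
noncomputable def MPoly (r : ℕ) (a : ℕ → ℝ) : Polynomial ℝ :=
  1 + Polynomial.C 2 * ∑ j ∈ Finset.Icc 1 r, Polynomial.C ((1 - a j) ^ 2) * (chebT j) ^ 2

/-- The sup-norm of the derivative of `φ` on `[0,1]` (derivative taken within `[0,1]`). -/
noncomputable def phiDerivSup (φ : ℝ → ℝ) : ℝ :=
  ⨆ t : Set.Icc (0 : ℝ) 1, |derivWithin φ (Set.Icc 0 1) t|

theorem integral_chebMeasure (f : ℝ → ℝ) :
    ∫ y, f y ∂chebMeasure = Real.pi⁻¹ * ∫ y, f y ∂Chebyshev.measureT := by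
  rw [Chebyshev.integral_measureT, chebMeasure,
    integral_withDensity_eq_integral_toReal_smul (by fun_prop)
      (Filter.Eventually.of_forall fun _ => ENNReal.ofReal_lt_top),
    integral_Icc_eq_integral_Ioc, intervalIntegral.integral_of_le (by norm_num),
    ← integral_const_mul]
  congr 1
  funext y
  have : 0 ≤ 1 / (Real.pi * Real.sqrt (1 - y ^ 2)) := by positivity
  rw [ENNReal.toReal_ofReal this, smul_eq_mul, Real.sqrt_inv]
  field_simp

theorem integral_T_chebMeasure (n : ℤ) :
    ∫ y, (Chebyshev.T ℝ n).eval y ∂chebMeasure = if n = 0 then 1 else 0 := by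
  rw [integral_chebMeasure]
  split_ifs with h
  · rw [h, Chebyshev.integral_eval_T_real_measureT_zero, inv_mul_cancel₀ Real.pi_ne_zero]
  · rw [Chebyshev.integral_eval_T_real_measureT_of_ne_zero h, mul_zero]

theorem T_eval_mul (x : ℝ) (m n : ℤ) :
    2 * (Chebyshev.T ℝ m).eval x * (Chebyshev.T ℝ n).eval x =
      (Chebyshev.T ℝ (m + n)).eval x + (Chebyshev.T ℝ (m - n)).eval x := by
  simpa using congrArg (Polynomial.eval x) (Chebyshev.T_mul_T ℝ m n)

theorem integral_T_mul_T_mul_T_chebMeasure (k i j : ℤ) :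
    ∫ y, (Chebyshev.T ℝ k).eval y * ((Chebyshev.T ℝ i).eval y * (Chebyshev.T ℝ j).eval y)
        ∂chebMeasure =
      ((if k - i - j = 0 then 1 else 0) + (if k - i + j = 0 then 1 else 0)
        + (if k + i - j = 0 then 1 else 0) + (if k + i + j = 0 then 1 else 0)) / 4 := by
  have h : ∀ y : ℝ, (Chebyshev.T ℝ k).eval y *
      ((Chebyshev.T ℝ i).eval y * (Chebyshev.T ℝ j).eval y) =
      (4 : ℝ)⁻¹ * ((Chebyshev.T ℝ (k - i - j)).eval y + (Chebyshev.T ℝ (k - i + j)).eval y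
        + (Chebyshev.T ℝ (k + i - j)).eval y + (Chebyshev.T ℝ (k + i + j)).eval y) := fun y => by
    linear_combination ((Chebyshev.T ℝ j).eval y) / 2 * T_eval_mul y k i
      + T_eval_mul y (k + i) j / 4 + T_eval_mul y (k - i) j / 4
  simp_rw [h, ← integral_T_chebMeasure, integral_chebMeasure]
  rw [integral_const_mul, integral_add, integral_add, integral_add]
  · ring
  all_goals exact Chebyshev.integrable_measureT (by fun_prop)

theorem sum_Icc_neg_eq {f : ℤ → ℝ} (hf : ∀ j, f (-j) = f j) (r : ℕ) :
    ∑ j ∈ Finset.Icc (-(r : ℤ)) r, f j = f 0 + 2 * ∑ j ∈ Finset.Icc 1 r, f (j : ℕ) := by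
  induction r with
  | zero => simp
  | succ n ih =>
    have h : Finset.Icc (-((n + 1 : ℕ) : ℤ)) (n + 1 : ℕ) =
        insert (-((n + 1 : ℕ) : ℤ)) (insert ((n + 1 : ℕ) : ℤ) (Finset.Icc (-(n : ℤ)) n)) := by
      ext j; simp only [Finset.mem_Icc, Finset.mem_insert]; omega
    rw [h, Finset.sum_insert, Finset.sum_insert, ih, Finset.sum_Icc_succ_top (by omega), hf]
    · ring
    all_goals simp only [Finset.mem_Icc, Finset.mem_insert]; omega

theorem sum_Icc_neg_comp_neg (f : ℤ → ℝ) (r : ℕ) :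
    ∑ j ∈ Finset.Icc (-(r : ℤ)) r, f (-j) = ∑ j ∈ Finset.Icc (-(r : ℤ)) r, f j := by
  refine Finset.sum_nbij' (fun j => -j) (fun j => -j) ?_ ?_ ?_ ?_ ?_ <;>
    simp only [Finset.mem_Icc] <;> intros <;> first | omega | trivial

/-- Integrating `T_k` against the square of an even Chebyshev sum gives a convolution. -/
theorem integral_T_mul_sq_sum {r : ℕ} {g : ℤ → ℝ} (hg : ∀ j, g (-j) = g j)
    (hz : ∀ j : ℤ, (r : ℤ) ≤ |j| → g j = 0) (k : ℤ) :
    ∫ y, (Chebyshev.T ℝ k).eval y *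
        (∑ j ∈ Finset.Icc (-(r : ℤ)) r, g j * (Chebyshev.T ℝ j).eval y) ^ 2 ∂chebMeasure =
      ∑ i ∈ Finset.Icc (-(r : ℤ)) r, g i * g (k - i) := by
  set I := Finset.Icc (-(r : ℤ)) r with hI
  have h1 : ∀ y : ℝ, (Chebyshev.T ℝ k).eval y *
      (∑ j ∈ I, g j * (Chebyshev.T ℝ j).eval y) ^ 2 =
      ∑ i ∈ I, ∑ j ∈ I, (g i * g j) * ((Chebyshev.T ℝ k).eval y *
        ((Chebyshev.T ℝ i).eval y * (Chebyshev.T ℝ j).eval y)) := fun y => by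
    rw [sq, Finset.sum_mul_sum, Finset.mul_sum]
    refine Finset.sum_congr rfl fun i _ => ?_
    rw [Finset.mul_sum]
    exact Finset.sum_congr rfl fun j _ => by ring
  have h2 : ∫ y, ∑ i ∈ I, ∑ j ∈ I, (g i * g j) * ((Chebyshev.T ℝ k).eval y *
        ((Chebyshev.T ℝ i).eval y * (Chebyshev.T ℝ j).eval y)) ∂chebMeasure =
      ∑ i ∈ I, ∑ j ∈ I, (g i * g j) * ∫ y, (Chebyshev.T ℝ k).eval y *
        ((Chebyshev.T ℝ i).eval y * (Chebyshev.T ℝ j).eval y) ∂chebMeasure := by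
    have hint : ∀ i j : ℤ, Integrable (fun y => (g i * g j) * ((Chebyshev.T ℝ k).eval y *
        ((Chebyshev.T ℝ i).eval y * (Chebyshev.T ℝ j).eval y))) Chebyshev.measureT := fun i j =>
      Chebyshev.integrable_measureT (by fun_prop)
    simp_rw [integral_chebMeasure]
    rw [integral_finsetSum _ fun i _ => integrable_finsetSum _ fun j _ => hint i j,
      Finset.mul_sum]
    refine Finset.sum_congr rfl fun i _ => ?_
    rw [integral_finsetSum _ fun j _ => hint i j, Finset.mul_sum]
    refine Finset.sum_congr rfl fun j _ => ?_
    rw [integral_const_mul]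
    ring
  let d : ℤ → ℝ := fun n => if n = 0 then 1 else 0
  have hj : ∀ i : ℤ, ∑ j ∈ I, g i * g j * d (k - i + j) = ∑ j ∈ I, g i * g j * d (k - i - j) :=
    fun i => by
      rw [← sum_Icc_neg_comp_neg]
      simp only [hg, ← sub_eq_add_neg, hI]
  have hi : ∑ i ∈ I, ∑ j ∈ I, g i * g j * d (k + i - j) =
      ∑ i ∈ I, ∑ j ∈ I, g i * g j * d (k - i - j) := by
    rw [← sum_Icc_neg_comp_neg]
    simp only [hg, ← sub_eq_add_neg, hI]
  have hij : ∑ i ∈ I, ∑ j ∈ I, g i * g j * d (k + i + j) =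
      ∑ i ∈ I, ∑ j ∈ I, g i * g j * d (k - i - j) := by
    rw [← sum_Icc_neg_comp_neg]
    simp only [hg, ← sub_eq_add_neg, ← hI, hj]
  have h3 : ∑ i ∈ I, ∑ j ∈ I, (g i * g j) * ((d (k - i - j) + d (k - i + j)
      + d (k + i - j) + d (k + i + j)) / 4) = ∑ i ∈ I, ∑ j ∈ I, g i * g j * d (k - i - j) := by
    calc _ = (∑ i ∈ I, ∑ j ∈ I, g i * g j * d (k - i - j)
          + ∑ i ∈ I, ∑ j ∈ I, g i * g j * d (k - i + j)
          + ∑ i ∈ I, ∑ j ∈ I, g i * g j * d (k + i - j)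
          + ∑ i ∈ I, ∑ j ∈ I, g i * g j * d (k + i + j)) / 4 := by
          simp only [← Finset.sum_add_distrib, Finset.sum_div]
          exact Finset.sum_congr rfl fun i _ => Finset.sum_congr rfl fun j _ => by ring
      _ = _ := by rw [hi, hij]; simp only [hj]; ring
  simp_rw [h1]
  rw [h2]
  simp_rw [integral_T_mul_T_mul_T_chebMeasure]
  refine h3.trans (Finset.sum_congr rfl fun i _ => ?_)
  by_cases hmem : k - i ∈ I
  · rw [Finset.sum_eq_single_of_mem (k - i) hmem]
    · simp [d]
    · intro j _ hne
      have : k - i - j ≠ 0 := fun h => hne (by omega)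
      simp [d, this]
  · have hki : g (k - i) = 0 := hz _ (by
      simp only [hI, Finset.mem_Icc, not_and_or, not_le] at hmem
      rw [le_abs]; omega)
    rw [hki, mul_zero]
    refine Finset.sum_eq_zero fun j hjI => ?_
    have : k - i - j ≠ 0 := fun h => hmem (by rwa [show k - i = j by omega])
    simp [d, this]

/-- The convolution minus the diagonal is a sum weighted by squared differences. -/
theorem convolution_sub_eq {r : ℕ} {b t : ℤ → ℝ} (hb : ∀ j, b (-j) = b j)
    (hz : ∀ j : ℤ, (r : ℤ) ≤ |j| → b j = 0) (ht0 : t 0 = 1) (ht : ∀ j, t (-j) = t j)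
    (hmul : ∀ m n, 2 * t m * t n = t (m + n) + t (m - n)) (k : ℕ) :
    (∑ i ∈ Finset.Icc (-(r : ℤ)) r, (b i * t i) * (b (k - i) * t (k - i)))
        - (∑ i ∈ Finset.Icc (-(r : ℤ)) r, b i ^ 2 * t i ^ 2) * t k =
      ∑ i ∈ Finset.Ioo (-(r : ℤ)) (r + k),
        (-(b i - b (k - i)) ^ 2 / 4) * (t k + t (2 * i - k)) := by
  set I := Finset.Icc (-(r : ℤ)) r
  set J := Finset.Ioo (-(r : ℤ)) (r + k)
  have hIJ : ∀ f : ℤ → ℝ, (∀ j : ℤ, (r : ℤ) ≤ |j| → f j = 0) →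
      ∑ i ∈ I, f i = ∑ i ∈ J, f i := by
    intro f hf
    have h : ∀ A : Finset ℤ, Finset.Ioo (-(r : ℤ)) r ⊆ A →
        ∑ i ∈ A, f i = ∑ i ∈ Finset.Ioo (-(r : ℤ)) r, f i := fun A hA =>
      (Finset.sum_subset hA fun i _ hi => hf i (by
        simp only [Finset.mem_Ioo, not_and_or, not_lt] at hi
        rw [le_abs]; omega)).symm
    rw [h I, h J]
    · intro i; simp only [J, Finset.mem_Ioo]; omega
    · intro i; simp only [I, Finset.mem_Icc, Finset.mem_Ioo]; omega
  have hrefl : ∀ f : ℤ → ℝ, ∑ i ∈ J, f (k - i) = ∑ i ∈ J, f i := fun f => by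
    refine Finset.sum_nbij' (fun j => k - j) (fun j => k - j) ?_ ?_ ?_ ?_ ?_ <;>
      simp only [J, Finset.mem_Ioo] <;> intros <;> first | omega | trivial
  have hM : (∑ i ∈ I, b i ^ 2 * t i ^ 2) * t k =
      ∑ i ∈ J, b i ^ 2 / 2 * (t k + t (2 * i - k)) := by
    have h1 : ∑ i ∈ I, b i ^ 2 * t (2 * i + k) = ∑ i ∈ I, b i ^ 2 * t (2 * i - k) := by
      rw [← sum_Icc_neg_comp_neg]
      refine Finset.sum_congr rfl fun i _ => ?_
      rw [hb, ← ht]; congr 2; ring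
    calc _ = (∑ i ∈ I, b i ^ 2 * t (2 * i + k)) / 4 + ∑ i ∈ I, b i ^ 2 * t (2 * i - k) / 4
          + ∑ i ∈ I, b i ^ 2 * t k / 2 := by
          rw [Finset.sum_mul, Finset.sum_div, ← Finset.sum_add_distrib, ← Finset.sum_add_distrib]
          refine Finset.sum_congr rfl fun i _ => ?_
          have e1 := hmul i i
          have e2 := hmul (2 * i) k
          rw [sub_self, ht0, ← two_mul] at e1
          linear_combination (b i ^ 2 * t k / 2) * e1 + b i ^ 2 / 4 * e2
      _ = ∑ i ∈ I, b i ^ 2 / 2 * (t k + t (2 * i - k)) := by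
          rw [h1, Finset.sum_div, ← Finset.sum_add_distrib, ← Finset.sum_add_distrib]
          exact Finset.sum_congr rfl fun i _ => by ring
      _ = _ := hIJ _ fun j hj => by rw [hz j hj]; ring
  have hM' : ∑ i ∈ J, b i ^ 2 / 2 * (t k + t (2 * i - k)) =
      ∑ i ∈ J, b (k - i) ^ 2 / 2 * (t k + t (2 * i - k)) := by
    rw [← hrefl]
    refine Finset.sum_congr rfl fun i _ => ?_
    rw [← ht (2 * i - k)]; congr 3; ring
  have hconv : ∑ i ∈ I, (b i * t i) * (b (k - i) * t (k - i)) =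
      ∑ i ∈ J, b i * b (k - i) / 2 * (t k + t (2 * i - k)) := by
    rw [hIJ _ fun j hj => by rw [hz j hj]; ring]
    refine Finset.sum_congr rfl fun i _ => ?_
    have e := hmul i (k - i)
    rw [show i + (k - i) = (k : ℤ) by ring, show i - (k - i) = 2 * i - (k : ℤ) by ring] at e
    linear_combination (b i * b (k - i) / 2) * e
  have hhalf : ∑ i ∈ J, b i ^ 2 / 2 * (t k + t (2 * i - k)) =
      ∑ i ∈ J, (b i ^ 2 + b (k - i) ^ 2) / 4 * (t k + t (2 * i - k)) := by
    calc _ = (∑ i ∈ J, b i ^ 2 / 2 * (t k + t (2 * i - k))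
          + ∑ i ∈ J, b (k - i) ^ 2 / 2 * (t k + t (2 * i - k))) / 2 := by rw [← hM']; ring
      _ = _ := by
        rw [← Finset.sum_add_distrib, Finset.sum_div]
        exact Finset.sum_congr rfl fun i _ => by ring
  rw [hM, hconv, hhalf, ← Finset.sum_sub_distrib]
  exact Finset.sum_congr rfl fun i _ => by ring

theorem cheb1Norm_sum_le {ι : Type*} (s : Finset ι) (w : ι → ℝ) (n : ι → ℤ) :
    cheb1Norm (∑ i ∈ s, C (w i) * Chebyshev.T ℝ (n i)) ≤ ∑ i ∈ s, |w i| := by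
  classical
  have key : ∃ c : ℕ →₀ ℝ, (∑ i ∈ s, C (w i) * Chebyshev.T ℝ (n i)) =
      c.sum (fun j coef => C coef * chebT j) ∧ c.sum (fun _ coef => |coef|) ≤ ∑ i ∈ s, |w i| := by
    induction s using Finset.induction_on with
    | empty => exact ⟨0, by simp⟩
    | insert a s ha ih =>
      obtain ⟨c, hc, hle⟩ := ih
      refine ⟨Finsupp.single (n a).natAbs (w a) + c, ?_, ?_⟩
      · rw [Finset.sum_insert ha, hc, Finsupp.sum_add_index' (by simp)
          (by intros; rw [C_add, add_mul]), Finsupp.sum_single_index (by simp), chebT,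
          Chebyshev.T_natAbs]
      · rw [Finset.sum_insert ha]
        set d := Finsupp.single (n a).natAbs (w a) with hd
        have hd1 : d.sum (fun _ coef => |coef|) = |w a| := by
          rw [hd, Finsupp.sum_single_index (by simp)]
        rw [← hd1]
        refine le_trans ?_ (add_le_add_right hle _)
        rw [Finsupp.sum_of_support_subset _ Finsupp.support_add _ (by simp),
          Finsupp.sum_of_support_subset d (Finset.subset_union_left (s₂ := c.support)) _ (by simp),
          Finsupp.sum_of_support_subset c (Finset.subset_union_right (s₁ := d.support)) _ (by simp),
          ← Finset.sum_add_distrib]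
        exact Finset.sum_le_sum fun i _ => abs_add_le _ _
  obtain ⟨c, hc, hle⟩ := key
  refine le_trans (csInf_le ⟨0, ?_⟩ ⟨c, hc, rfl⟩) hle
  rintro _ ⟨c, -, rfl⟩
  exact Finset.sum_nonneg fun _ _ => abs_nonneg _

theorem abs_sub_le_phiDerivSup_mul {φ : ℝ → ℝ} (h1 : ∀ x : ℝ, 1 ≤ x → φ x = 1)
    (hC1 : ContDiffOn ℝ 1 φ (Set.Icc 0 1)) {u v : ℝ} (hu : 0 ≤ u) (hv : 0 ≤ v) :
    |φ u - φ v| ≤ phiDerivSup φ * |u - v| := by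
  have hcd := hC1.continuousOn_derivWithin (uniqueDiffOn_Icc zero_lt_one) le_rfl
  have hbdd : BddAbove (Set.range fun t : Set.Icc (0 : ℝ) 1 =>
      |derivWithin φ (Set.Icc 0 1) t|) := by
    have := (isCompact_Icc.image_of_continuousOn hcd.abs).bddAbove
    rwa [Set.image_eq_range] at this
  have hbound : ∀ x ∈ Set.Icc (0 : ℝ) 1, ‖derivWithin φ (Set.Icc 0 1) x‖ ≤ phiDerivSup φ :=
    fun x hx => le_ciSup hbdd ⟨x, hx⟩
  have hL : 0 ≤ phiDerivSup φ := (norm_nonneg _).trans (hbound 0 (by simp))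
  have hmin : ∀ x, φ x = φ (min x 1) := fun x => by
    rcases le_total x 1 with h | h
    · rw [min_eq_left h]
    · rw [min_eq_right h, h1 x h, h1 1 le_rfl]
  rw [hmin u, hmin v]
  refine ((convex_Icc (0 : ℝ) 1).norm_image_sub_le_of_norm_derivWithin_le
    (hC1.differentiableOn one_ne_zero) hbound (x := min v 1) (y := min u 1)
    ⟨le_min hv zero_le_one, min_le_right _ _⟩ ⟨le_min hu zero_le_one, min_le_right _ _⟩).trans ?_
  refine mul_le_mul_of_nonneg_left ?_ hL
  simpa using abs_min_sub_min_le_max u 1 v 1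

/-- Chebyshev-norm bound for `K_r^{(a)}(T_k) - M_r^{(a)} T_k` with
weights `a_j = φ(j/r)`. -/
theorem cheb1Norm_kernel_error_bound (φ : ℝ → ℝ) (hcont : Continuous φ)
    (h0 : ∀ x : ℝ, x ≤ 0 → φ x = 0) (h1 : ∀ x : ℝ, 1 ≤ x → φ x = 1)
    (hC1 : ContDiffOn ℝ 1 φ (Set.Icc 0 1))
    (r : ℕ) (hr : 1 ≤ r) (k : ℕ) (hk : k ≤ r)
    (Q : Polynomial ℝ)
    (hQ : ∀ x : ℝ, Q.eval x =
      ∫ y, (chebT k).eval y * (Sker r (fun j => φ ((j : ℝ) / r)) x y) ^ 2 ∂chebMeasure) :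
    cheb1Norm (Q - MPoly r (fun j => φ ((j : ℝ) / r)) * chebT k) ≤
      φ ((k : ℝ) / r) ^ 2 + (3 * (k : ℝ) ^ 2 / (2 * r)) * (phiDerivSup φ) ^ 2 := by
  have hr0 : (0 : ℝ) < r := by exact_mod_cast hr
  let b : ℤ → ℝ := fun j => 1 - φ (|(j : ℝ)| / r)
  have hb : ∀ j, b (-j) = b j := fun j => by simp [b]
  have hb0 : b 0 = 1 := by simp [b, h0 0 le_rfl]
  have hbn : ∀ j : ℕ, b j = 1 - φ ((j : ℝ) / r) := fun j => by simp [b]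
  have hz : ∀ j : ℤ, (r : ℤ) ≤ |j| → b j = 0 := fun j hj => by
    have : (1 : ℝ) ≤ |(j : ℝ)| / r := by
      rw [le_div_iff₀ hr0, one_mul]; exact_mod_cast hj
    simp [b, h1 _ this]
  have hS : ∀ x y : ℝ, Sker r (fun j => φ ((j : ℝ) / r)) x y =
      ∑ j ∈ Finset.Icc (-(r : ℤ)) r,
        (b j * (Chebyshev.T ℝ j).eval x) * (Chebyshev.T ℝ j).eval y := fun x y => by
    rw [sum_Icc_neg_eq fun j => by rw [hb, Chebyshev.T_neg]]
    simp [Sker, hb0, hbn, chebT]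
  have hM : ∀ x : ℝ, (MPoly r (fun j => φ ((j : ℝ) / r))).eval x =
      ∑ j ∈ Finset.Icc (-(r : ℤ)) r, b j ^ 2 * (Chebyshev.T ℝ j).eval x ^ 2 := fun x => by
    rw [sum_Icc_neg_eq fun j => by rw [hb, Chebyshev.T_neg]]
    simp [MPoly, hb0, hbn, chebT, eval_finsetSum]
  set J := Finset.Ioo (-(r : ℤ)) (r + k) with hJ
  let w : ℤ → ℝ := fun i => -(b i - b (k - i)) ^ 2 / 4
  have hD : Q - MPoly r (fun j => φ ((j : ℝ) / r)) * chebT k =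
      ∑ p ∈ J ×ˢ (Finset.univ : Finset Bool),
        C (w p.1) * Chebyshev.T ℝ (if p.2 then (k : ℤ) else 2 * p.1 - k) := by
    refine Polynomial.funext fun x => ?_
    rw [eval_sub, eval_mul, hQ, hM, Finset.sum_product]
    simp_rw [hS]
    rw [chebT, integral_T_mul_sq_sum (fun j => by rw [hb, Chebyshev.T_neg])
      (fun j hj => by rw [hz j hj, zero_mul]),
      convolution_sub_eq (t := fun n => (Chebyshev.T ℝ n).eval x) hb hz (by simp)
        (fun j => by rw [Chebyshev.T_neg]) (T_eval_mul x)]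
    simp [eval_finsetSum, w, mul_add, hJ]
  have hw : ∀ i, |w i| ≤ (phiDerivSup φ * (k / r)) ^ 2 / 4 := fun i => by
    have hdiff : |b i - b (k - i)| ≤ phiDerivSup φ * (k / r) := by
      have h := abs_sub_le_phiDerivSup_mul h1 hC1
        (u := |((k - i : ℤ) : ℝ)| / r) (v := |(i : ℝ)| / r) (by positivity) (by positivity)
      have hL : 0 ≤ phiDerivSup φ := Real.iSup_nonneg fun _ => abs_nonneg _
      rw [show b i - b (k - i) = φ (|((k - i : ℤ) : ℝ)| / r) - φ (|(i : ℝ)| / r) by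
        simp only [b]; ring]
      refine h.trans (mul_le_mul_of_nonneg_left ?_ hL)
      rw [← sub_div, abs_div, abs_of_pos hr0]
      gcongr
      have := abs_abs_sub_abs_le ((k - i : ℤ) : ℝ) (-(i : ℝ))
      rw [abs_neg] at this
      simpa using this
    have : |w i| = |b i - b (k - i)| ^ 2 / 4 := by
      simp [w, abs_div, abs_neg]
    rw [this]
    gcongr
  rw [hD]
  calc _ ≤ ∑ p ∈ J ×ˢ (Finset.univ : Finset Bool), |w p.1| := cheb1Norm_sum_le _ _ _
    _ ≤ ∑ p ∈ J ×ˢ (Finset.univ : Finset Bool), (phiDerivSup φ * (k / r)) ^ 2 / 4 :=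
      Finset.sum_le_sum fun p _ => hw p.1
    _ = (J.card * 2) * ((phiDerivSup φ * (k / r)) ^ 2 / 4) := by
      simp
    _ ≤ (3 * r * 2) * ((phiDerivSup φ * (k / r)) ^ 2 / 4) := by
      have hcard : J.card ≤ 3 * r := by rw [hJ, Int.card_Ioo]; omega
      have : (J.card : ℝ) ≤ 3 * r := by exact_mod_cast hcard
      gcongr
    _ = (3 * (k : ℝ) ^ 2 / (2 * r)) * (phiDerivSup φ) ^ 2 := by field_simp; ring
    _ ≤ _ := le_add_of_nonneg_left (sq_nonneg _)
end

section
/- Let r ≥ 1 be an integer, a = (a_1,…,a_r) ∈ [0,1]^r, and let N be an even natural number. Let f be a univariate real polynomial with f(y) ≥ 0 for all y ∈ [−1,1]. Then there exist finitely many univariate real polynomials h_1,…,h_s, each of degree at most r(N+1), such that for all x ∈ ℝ: p_{r,N}^{(a)}(x)·∫_{−1}^{1} f(y)·S_r^{(a)}(x,y)² dμ(y) = ∑_{i=1}^{s} h_i(x)². -/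
open Polynomial MeasureTheory

/-- `C = 1 + 2∑_{j=1}^r (1-a_j)²`. -/
noncomputable def Cval (r : ℕ) (a : ℕ → ℝ) : ℝ := 1 + 2 * ∑ j ∈ Finset.Icc 1 r, (1 - a j) ^ 2

/-- The polynomial `p_{r,N}^{(a)} = (1/C) ∑_{m=0}^{N} (1 - M_r^{(a)}/C)^m`. -/
noncomputable def pPoly (r : ℕ) (a : ℕ → ℝ) (N : ℕ) : Polynomial ℝ :=
  Polynomial.C (1 / Cval r a) *
    ∑ m ∈ Finset.range (N + 1), ((1 : Polynomial ℝ) - Polynomial.C (1 / Cval r a) * MPoly r a) ^ m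

/-- `q` is a finite sum of squares of polynomials of degree at most `d`. -/
def IsSumSqNatDegreeLE (d : ℕ) (q : Polynomial ℝ) : Prop :=
  ∃ (ι : Type) (_ : Fintype ι) (h : ι → Polynomial ℝ),
    (∀ i, (h i).natDegree ≤ d) ∧ q = ∑ i, h i ^ 2

theorem IsSumSqNatDegreeLE.mul {d e : ℕ} {p q : Polynomial ℝ}
    (hp : IsSumSqNatDegreeLE d p) (hq : IsSumSqNatDegreeLE e q) :
    IsSumSqNatDegreeLE (d + e) (p * q) := by
  obtain ⟨ι, _, g, hg, rfl⟩ := hp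
  obtain ⟨κ, _, h, hh, rfl⟩ := hq
  refine ⟨ι × κ, inferInstance, fun i => g i.1 * h i.2,
    fun i => natDegree_mul_le_of_le (hg i.1) (hh i.2), ?_⟩
  rw [Finset.sum_mul_sum, Fintype.sum_prod_type]
  simp only [mul_pow]

theorem IsSumSqNatDegreeLE.C_mul {d : ℕ} {q : Polynomial ℝ} (hq : IsSumSqNatDegreeLE d q)
    {c : ℝ} (hc : 0 ≤ c) : IsSumSqNatDegreeLE d (C c * q) := by
  obtain ⟨ι, _, h, hh, rfl⟩ := hq
  refine ⟨ι, inferInstance, fun i => C (√c) * h i,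
    fun i => (natDegree_C_mul_le _ _).trans (hh i), ?_⟩
  simp only [mul_pow, ← C_pow, Real.sq_sqrt hc, Finset.mul_sum]

theorem two_mul_geom_sum_eq {R : Type*} [CommRing R] (t : R) (k : ℕ) :
    2 * ∑ m ∈ Finset.range (2 * k + 1), t ^ m =
      1 + (t ^ k) ^ 2 + ∑ i ∈ Finset.range k, (t ^ i * (1 + t)) ^ 2 := by
  induction k with
  | zero => simp; norm_num
  | succ k ih =>
    rw [show 2 * (k + 1) + 1 = 2 * k + 1 + 1 + 1 by ring, Finset.sum_range_succ,
      Finset.sum_range_succ, mul_add, mul_add, ih, Finset.sum_range_succ]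
    ring

theorem isSumSqNatDegreeLE_geom_sum {d : ℕ} {t : Polynomial ℝ} (ht : t.natDegree ≤ d) (k : ℕ) :
    IsSumSqNatDegreeLE (k * d) (∑ m ∈ Finset.range (2 * k + 1), t ^ m) := by
  have h2 : IsSumSqNatDegreeLE (k * d) (2 * ∑ m ∈ Finset.range (2 * k + 1), t ^ m) := by
    refine ⟨Bool ⊕ Fin k, inferInstance,
      Sum.elim (fun b => bif b then 1 else t ^ k) (fun i => t ^ (i : ℕ) * (1 + t)), ?_, ?_⟩
    · rintro ((_ | _) | i)
      · exact natDegree_pow_le_of_le k ht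
      · simp
      · have h1 : (1 + t).natDegree ≤ d := natDegree_add_le_of_degree_le (by simp) ht
        refine (natDegree_mul_le_of_le (natDegree_pow_le_of_le i ht) h1).trans ?_
        rw [← Nat.succ_mul]
        exact Nat.mul_le_mul_right d i.2
    · rw [two_mul_geom_sum_eq, Finset.sum_range]
      simp
  convert h2.C_mul (c := 1 / 2) (by norm_num) using 1
  rw [← mul_assoc, ← C_ofNat, ← C_mul]
  norm_num

/-- The weighted quadratic form `c ↦ ∫ w (∑ cᵢ φᵢ)²` with weight `w ≥ 0` on a finite-dimensional
space is a sum of squares of linear forms. -/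
theorem exists_integral_mul_sq_eq_sum_sq {α ι : Type*} [MeasurableSpace α] [Fintype ι]
    {ν : Measure α} {w : α → ℝ} (hw : ∀ᵐ y ∂ν, 0 ≤ w y) (φ : ι → α → ℝ)
    (hint : ∀ i j, Integrable (fun y => w y * (φ i y * φ j y)) ν) :
    ∃ (s : ℕ) (v : Fin s → ι → ℝ), ∀ c : ι → ℝ,
      ∫ y, w y * (∑ i, c i * φ i y) ^ 2 ∂ν = ∑ k, (∑ i, c i * v k i) ^ 2 := by
  let G : Matrix ι ι ℝ := fun i j => ∫ y, w y * (φ i y * φ j y) ∂ν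
  have hG : ∀ c : ι → ℝ,
      ∫ y, w y * (∑ i, c i * φ i y) ^ 2 ∂ν = ∑ i, ∑ j, c i * c j * G i j := by
    intro c
    have hexp : ∀ y, w y * (∑ i, c i * φ i y) ^ 2 =
        ∑ i, ∑ j, c i * c j * (w y * (φ i y * φ j y)) := by
      intro y
      rw [sq, Finset.sum_mul_sum]
      simp only [Finset.mul_sum]
      exact Finset.sum_congr rfl fun i _ => Finset.sum_congr rfl fun j _ => by ring
    simp only [hexp]
    rw [integral_finsetSum _ fun i _ => integrable_finsetSum _ fun j _ => (hint i j).const_mul _]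
    refine Finset.sum_congr rfl fun i _ => ?_
    rw [integral_finsetSum _ fun j _ => (hint i j).const_mul _]
    exact Finset.sum_congr rfl fun j _ => integral_const_mul _ _
  have hpos : G.PosSemidef := by
    refine .of_dotProduct_mulVec_nonneg ?_ fun c => ?_
    · ext i j
      rw [Matrix.conjTranspose_apply, star_trivial]
      exact integral_congr_ae (.of_forall fun y => by ring)
    · have h : star c ⬝ᵥ G.mulVec c = ∫ y, w y * (∑ i, c i * φ i y) ^ 2 ∂ν := by
        rw [hG]
        simp only [dotProduct, Matrix.mulVec, Finset.mul_sum, star_trivial]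
        exact Finset.sum_congr rfl fun i _ => Finset.sum_congr rfl fun j _ => by ring
      rw [h]
      refine integral_nonneg_of_ae ?_
      filter_upwards [hw] with y hy
      exact mul_nonneg hy (sq_nonneg _)
  obtain ⟨s, v, hv⟩ := Matrix.posSemidef_iff_eq_sum_vecMulVec.mp hpos
  refine ⟨s, v, fun c => ?_⟩
  rw [hG]
  simp only [hv, Matrix.sum_apply, Matrix.vecMulVec_apply, star_trivial,
    Finset.mul_sum]
  calc ∑ i, ∑ j, ∑ k, c i * c j * (v k i * v k j)
      = ∑ i, ∑ k, ∑ j, c i * c j * (v k i * v k j) :=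
        Finset.sum_congr rfl fun i _ => Finset.sum_comm
    _ = ∑ k, ∑ i, ∑ j, c i * c j * (v k i * v k j) := Finset.sum_comm
    _ = ∑ k, (∑ i, c i * v k i) ^ 2 := by
        simp only [sq, Finset.sum_mul_sum]
        exact Finset.sum_congr rfl fun k _ => Finset.sum_congr rfl fun i _ =>
          Finset.sum_congr rfl fun j _ => by ring

theorem integrable_chebMeasure {g : ℝ → ℝ} (hg : Continuous g) : Integrable g chebMeasure := by
  rw [chebMeasure, integrable_withDensity_iff (by fun_prop)
    (.of_forall fun _ => ENNReal.ofReal_lt_top),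
    ← IntegrableOn, integrableOn_Icc_iff_integrableOn_Ioc,
    ← intervalIntegrable_iff_integrableOn_Ioc_of_le (by norm_num)]
  have h := (Chebyshev.intervalIntegrable_sqrt_one_sub_sq_inv.const_mul Real.pi⁻¹).continuousOn_mul
    hg.continuousOn
  refine h.congr fun y _ => ?_
  have : 0 ≤ 1 / (Real.pi * √(1 - y ^ 2)) := by positivity
  rw [ENNReal.toReal_ofReal this, Real.sqrt_inv, one_div, mul_inv]

theorem ae_mem_Icc_chebMeasure : ∀ᵐ y ∂chebMeasure, y ∈ Set.Icc (-1 : ℝ) 1 :=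
  (withDensity_absolutelyContinuous _ _).ae_le (ae_restrict_mem measurableSet_Icc)

theorem natDegree_chebT (k : ℕ) : (chebT k).natDegree = k := by
  simp [chebT]

theorem Cval_pos (r : ℕ) (a : ℕ → ℝ) : 0 < Cval r a := by
  have : 0 ≤ ∑ j ∈ Finset.Icc 1 r, (1 - a j) ^ 2 := Finset.sum_nonneg fun _ _ => sq_nonneg _
  unfold Cval
  positivity

theorem natDegree_MPoly_le (r : ℕ) (a : ℕ → ℝ) : (MPoly r a).natDegree ≤ 2 * r := by
  refine natDegree_add_le_of_degree_le (by simp) ((natDegree_C_mul_le _ _).trans ?_)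
  refine natDegree_sum_le_of_forall_le _ _ fun j hj => (natDegree_C_mul_le _ _).trans ?_
  refine natDegree_pow_le_of_le 2 ?_
  rw [natDegree_chebT]
  exact (Finset.mem_Icc.mp hj).2

theorem isSumSqNatDegreeLE_pPoly (r : ℕ) (a : ℕ → ℝ) {N : ℕ} (hN : Even N) :
    IsSumSqNatDegreeLE (r * N) (pPoly r a N) := by
  obtain ⟨k, rfl⟩ := hN
  have ht : ((1 : Polynomial ℝ) - C (1 / Cval r a) * MPoly r a).natDegree ≤ 2 * r :=
    (natDegree_sub_le _ _).trans
      (max_le (by simp) ((natDegree_C_mul_le _ _).trans (natDegree_MPoly_le r a)))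
  have h := (isSumSqNatDegreeLE_geom_sum ht k).C_mul (one_div_nonneg.mpr (Cval_pos r a).le)
  rwa [show k * (2 * r) = r * (k + k) by ring, two_mul k] at h

theorem Sker_eq_sum (r : ℕ) (a : ℕ → ℝ) (x y : ℝ) :
    Sker r a x y = ∑ i : Fin (r + 1),
      (if (i : ℕ) = 0 then 1 else 2 * (1 - a i)) * (chebT i).eval x * (chebT i).eval y := by
  rw [← Finset.sum_range (fun i : ℕ =>
    (if i = 0 then 1 else 2 * (1 - a i)) * (chebT i).eval x * (chebT i).eval y),
    Finset.sum_range_succ', Sker, Finset.range_eq_Ico, Finset.sum_Ico_add' (fun i : ℕ =>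
    (if i = 0 then 1 else 2 * (1 - a i)) * (chebT i).eval x * (chebT i).eval y) 0 r 1,
    add_comm, Finset.mul_sum]
  congr 1
  · refine Finset.sum_congr (by ext; simp) fun i _ => ?_
    rw [if_neg (Nat.one_le_iff_ne_zero.mp (Finset.mem_Icc.mp ‹_›).1)]
    ring
  · simp [chebT]

theorem exists_isSumSqNatDegreeLE_integral_Sker (r : ℕ) (a : ℕ → ℝ) (f : Polynomial ℝ)
    (hf : ∀ y ∈ Set.Icc (-1 : ℝ) 1, 0 ≤ f.eval y) :
    ∃ q : Polynomial ℝ, IsSumSqNatDegreeLE r q ∧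
      ∀ x, ∫ y, f.eval y * (Sker r a x y) ^ 2 ∂chebMeasure = q.eval x := by
  obtain ⟨s, v, hv⟩ := exists_integral_mul_sq_eq_sum_sq (ν := chebMeasure) (w := fun y => f.eval y)
    (ae_mem_Icc_chebMeasure.mono hf) (fun (i : Fin (r + 1)) y => (chebT i).eval y)
    fun i j => integrable_chebMeasure (by fun_prop)
  let b : Fin (r + 1) → ℝ := fun i => if (i : ℕ) = 0 then 1 else 2 * (1 - a i)
  refine ⟨_, ⟨Fin s, inferInstance, fun k => ∑ i, C (b i * v k i) * chebT i, fun k => ?_, rfl⟩,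
    fun x => ?_⟩
  · refine natDegree_sum_le_of_forall_le _ _ fun i _ => (natDegree_C_mul_le _ _).trans ?_
    rw [natDegree_chebT]
    exact Nat.lt_succ_iff.mp i.2
  · simp only [Sker_eq_sum]
    rw [hv fun i => b i * (chebT i).eval x]
    simp only [eval_finsetSum, eval_pow, eval_mul, eval_C]
    refine Finset.sum_congr rfl fun k _ => ?_
    congr 1
    exact Finset.sum_congr rfl fun i _ => by ring

/-- `p_{r,N}^{(a)}(x) ∫ f(y) S_r^{(a)}(x,y)² dμ(y)` is a sum of squares
of polynomials of degree at most `r(N+1)`, for `N` even and `f ≥ 0` on `[-1,1]`. -/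
theorem kernel_image_is_SOS (r : ℕ) (hr : 1 ≤ r) (a : ℕ → ℝ)
    (ha : ∀ j ∈ Finset.Icc 1 r, a j ∈ Set.Icc (0 : ℝ) 1)
    (N : ℕ) (hN : Even N)
    (f : Polynomial ℝ) (hf : ∀ y ∈ Set.Icc (-1 : ℝ) 1, 0 ≤ f.eval y) :
    ∃ (s : ℕ) (h : Fin s → Polynomial ℝ),
      (∀ i, (h i).natDegree ≤ r * (N + 1)) ∧
      ∀ x : ℝ,
        (pPoly r a N).eval x * (∫ y, f.eval y * (Sker r a x y) ^ 2 ∂chebMeasure) =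
          ∑ i, ((h i).eval x) ^ 2 := by
  obtain ⟨q, hq, hint⟩ := exists_isSumSqNatDegreeLE_integral_Sker r a f hf
  obtain ⟨ι, _, h, hdeg, heq⟩ := (isSumSqNatDegreeLE_pPoly r a hN).mul hq
  let e := Fintype.equivFin ι
  refine ⟨Fintype.card ι, fun i => h (e.symm i), fun i => (hdeg _).trans_eq (by ring), fun x => ?_⟩
  rw [hint, ← eval_mul, heq, Equiv.sum_comp e.symm fun i => (h i).eval x ^ 2]
  simp [eval_finsetSum]
end
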